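/- Let AT be an argumentation theory and A an argument from AT. If A is redundant, then A is not minimal. -/

import Mathlib

/-- A rule over the language `L`: a finite list of premises and a conclusion. -/
structure ArgRule (L : Type) where
  prems : List L
  concl : L

/-- An argumentation theory: a set of rules and a knowledge base. -/
structure ArgTheory (L : Type) where
  rules : Set (ArgRule L)
  kb : Set L

/-- Raw argument structures: either an element of the knowledge base, or an
application of a rule to a list of sub-arguments. -/
inductive Arg (L : Type) : Type
  | atom (φ : L) : Arg L
  | node (children : List (Arg L)) (φ : L) : Arg L

namespace Arg

variable {L : Type}

/-- The conclusion of an argument. -/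
def Conc : Arg L → L
  | .atom φ => φ
  | .node _ φ => φ

/-- The premises (grounds) of an argument. -/
def Prem : Arg L → Set L
  | .atom φ => {φ}
  | .node cs _ => cs.attach.foldr (fun c acc => Prem c.1 ∪ acc) ∅
decreasing_by have := List.sizeOf_lt_of_mem c.2; simp_wf; omega

/-- The set of rules used in an argument. -/
def Rules : Arg L → Set (ArgRule L)
  | .atom _ => ∅
  | .node cs φ =>
      insert ⟨cs.map Conc, φ⟩ (cs.attach.foldr (fun c acc => Rules c.1 ∪ acc) ∅)
decreasing_by have := List.sizeOf_lt_of_mem c.2; simp_wf; omega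

/-- The sub-arguments of an argument (including the argument itself). -/
def Sub : Arg L → Set (Arg L)
  | .atom φ => {.atom φ}
  | .node cs φ => insert (.node cs φ) (cs.attach.foldr (fun c acc => Sub c.1 ∪ acc) ∅)
decreasing_by have := List.sizeOf_lt_of_mem c.2; simp_wf; omega

/-- The top rule of an argument (undefined for atomic arguments). -/
def TopRule : Arg L → Option (ArgRule L)
  | .atom _ => none
  | .node cs φ => some ⟨cs.map Conc, φ⟩

/-- `A.IsArg AT` holds when `A` is a genuine argument of the theory `AT`. -/
inductive IsArg (AT : ArgTheory L) : Arg L → Prop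
  | atom {φ : L} : φ ∈ AT.kb → IsArg AT (.atom φ)
  | node {cs : List (Arg L)} {φ : L} :
      (∀ c ∈ cs, IsArg AT c) →
      (⟨cs.map Conc, φ⟩ : ArgRule L) ∈ AT.rules →
      IsArg AT (.node cs φ)

end Arg

/-- `Infers P R p` (written `P ⊢_R p`): `p` is in the closure of `P` under the
rules `R`, i.e. in the least set containing `P` and closed under `R`. -/
inductive Infers (P : Set L) (R : Set (ArgRule L)) : L → Prop
  | base {p : L} : p ∈ P → Infers P R p
  | step {r : ArgRule L} : r ∈ R → (∀ q ∈ r.prems, Infers P R q) →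
      Infers P R r.concl

namespace Arg

variable {L : Type}

/-- An argument `(G, R, p)` is minimal if no strict subset `G'` of `G` has
`G' ⊢_R p` and no strict subset `R'` of `R` has `G ⊢_{R'} p`. -/
def Minimal (A : Arg L) : Prop :=
  (¬ ∃ G' : Set L, G' ⊂ A.Prem ∧ Infers G' A.Rules A.Conc) ∧
  (¬ ∃ R' : Set (ArgRule L), R' ⊂ A.Rules ∧ Infers A.Prem R' A.Conc)

/-- An argument is regular if no two distinct sub-arguments share a conclusion. -/
def Regular (A : Arg L) : Prop :=
  ¬ ∃ A₁ ∈ A.Sub, ∃ A₂ ∈ A.Sub, A₁ ≠ A₂ ∧ A₁.Conc = A₂.Conc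

/-- An argument is circular if it has distinct sub-arguments with the same
conclusion, one of which is a sub-argument of the other. -/
def Circular (A : Arg L) : Prop :=
  ∃ A₁ ∈ A.Sub, ∃ A₂ ∈ A.Sub, A₁ ≠ A₂ ∧ A₁.Conc = A₂.Conc ∧ A₁ ∈ A₂.Sub

/-- An argument is redundant if it has distinct sub-arguments with the same
conclusion, neither of which is a sub-argument of the other. -/
def Redundant (A : Arg L) : Prop :=
  ∃ A₁ ∈ A.Sub, ∃ A₂ ∈ A.Sub, A₁ ≠ A₂ ∧ A₁.Conc = A₂.Conc ∧
    A₁ ∉ A₂.Sub ∧ A₂ ∉ A₁.Sub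

end Arg

namespace Infers

variable {L : Type} {P : Set L} {R : Set (ArgRule L)}

theorem mono {R' : Set (ArgRule L)} (h : R ⊆ R') {q : L} (hq : Infers P R q) :
    Infers P R' q := by
  induction hq with
  | base hp => exact .base hp
  | step hr _ ih => exact .step (h hr) ih

/-- A rule whose conclusion is already given can be dropped. -/
theorem diff_of_concl_mem {r : ArgRule L} (hr : r.concl ∈ P) {q : L} (hq : Infers P R q) :
    Infers P (R \ {r}) q := by
  induction hq with
  | base hp => exact .base hp
  | @step s hs _ ih =>
    by_cases h : s = r
    · exact .base (h ▸ hr)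
    · exact .step ⟨hs, h⟩ ih

/-- Either `q` can be derived without any rule for `p`, or some rule for `p` is applicable
without having derived `p` before. -/
theorem avoid_or_exists_first (p : L) {q : L} (hq : Infers P R q) :
    Infers P (R \ {r | r.concl = p}) q ∨
      ∃ r ∈ R, r.concl = p ∧ ∀ x ∈ r.prems, Infers P (R \ {r | r.concl = p}) x := by
  induction hq with
  | base hp => exact .inl (.base hp)
  | @step s hs _ ih =>
    by_cases hfirst : ∃ r ∈ R, r.concl = p ∧
        ∀ x ∈ r.prems, Infers P (R \ {r | r.concl = p}) x
    · exact .inr hfirst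
    · have hprems x (hx : x ∈ s.prems) := (ih x hx).resolve_right hfirst
      by_cases hp : s.concl = p
      · exact .inr ⟨s, hs, hp, hprems⟩
      · exact .inl (.step ⟨hs, hp⟩ hprems)

/-- If two distinct rules share a conclusion, a strict subset of the rules suffices. -/
theorem exists_ssubset_of_concl_eq {r₁ r₂ : ArgRule L} (h₁ : r₁ ∈ R) (h₂ : r₂ ∈ R)
    (hne : r₁ ≠ r₂) (hc : r₁.concl = r₂.concl) {q : L} (hq : Infers P R q) :
    ∃ R' ⊂ R, Infers P R' q := by
  rcases hq.avoid_or_exists_first r₁.concl with h | ⟨r, hr, hrc, hprems⟩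
  · exact ⟨R \ {r | r.concl = r₁.concl}, ⟨Set.sdiff_subset, fun hsub => (hsub h₁).2 rfl⟩, h⟩
  · refine ⟨insert r (R \ {r | r.concl = r₁.concl}),
      ⟨Set.insert_subset hr Set.sdiff_subset, fun hsub => hne ?_⟩, ?_⟩
    · have e₁ : r₁ = r := (hsub h₁).resolve_right fun h => h.2 rfl
      have e₂ : r₂ = r := (hsub h₂).resolve_right fun h => h.2 hc.symm
      exact e₁.trans e₂.symm
    · induction hq with
      | base hp => exact .base hp
      | @step s hs _ ih =>
        by_cases h : s.concl = r₁.concl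
        · rw [h.trans hrc.symm]
          exact .step (Set.mem_insert _ _) fun x hx =>
            (hprems x hx).mono (Set.subset_insert _ _)
        · exact .step (Set.mem_insert_of_mem _ ⟨hs, h⟩) ih

end Infers

namespace Arg

variable {L : Type}

theorem mem_foldr_union {α β : Type} (f : α → Set β) (l : List α) (x : β) :
    x ∈ l.foldr (fun c acc => f c ∪ acc) ∅ ↔ ∃ c ∈ l, x ∈ f c := by
  induction l <;> simp_all

theorem mem_prem_node {cs : List (Arg L)} {φ x : L} :
    x ∈ (node cs φ).Prem ↔ ∃ c ∈ cs, x ∈ c.Prem := by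
  rw [Prem, mem_foldr_union (fun c : {c // c ∈ cs} => c.1.Prem)]
  simp

theorem mem_rules_node {cs : List (Arg L)} {φ : L} {r : ArgRule L} :
    r ∈ (node cs φ).Rules ↔ r = ⟨cs.map Conc, φ⟩ ∨ ∃ c ∈ cs, r ∈ c.Rules := by
  rw [Rules, Set.mem_insert_iff, mem_foldr_union (fun c : {c // c ∈ cs} => c.1.Rules)]
  simp

theorem mem_sub_node {cs : List (Arg L)} {φ : L} {B : Arg L} :
    B ∈ (node cs φ).Sub ↔ B = node cs φ ∨ ∃ c ∈ cs, B ∈ c.Sub := by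
  rw [Sub, Set.mem_insert_iff, mem_foldr_union (fun c : {c // c ∈ cs} => c.1.Sub)]
  simp

theorem induction_on_children {motive : Arg L → Prop} (atom : ∀ φ, motive (.atom φ))
    (node : ∀ cs φ, (∀ c ∈ cs, motive c) → motive (.node cs φ)) : ∀ A, motive A
  | .atom φ => atom φ
  | .node cs φ => node cs φ fun c _ => induction_on_children atom node c

theorem prem_subset_of_mem_sub {A B : Arg L} (h : B ∈ A.Sub) : B.Prem ⊆ A.Prem := by
  induction A using induction_on_children with
  | atom φ =>
    rw [Sub, Set.mem_singleton_iff] at h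
    rw [h]
  | node cs φ ih =>
    rcases mem_sub_node.1 h with rfl | ⟨c, hc, hB⟩
    · exact subset_rfl
    · exact fun x hx => mem_prem_node.2 ⟨c, hc, ih c hc hB hx⟩

theorem rules_subset_of_mem_sub {A B : Arg L} (h : B ∈ A.Sub) : B.Rules ⊆ A.Rules := by
  induction A using induction_on_children with
  | atom φ =>
    rw [Sub, Set.mem_singleton_iff] at h
    rw [h]
  | node cs φ ih =>
    rcases mem_sub_node.1 h with rfl | ⟨c, hc, hB⟩
    · exact subset_rfl
    · exact fun x hx => mem_rules_node.2 (.inr ⟨c, hc, ih c hc hB hx⟩)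

theorem infers_conc {P : Set L} {R : Set (ArgRule L)} {A : Arg L} (hP : A.Prem ⊆ P)
    (hR : A.Rules ⊆ R) : Infers P R A.Conc := by
  induction A using induction_on_children with
  | atom φ => exact .base (hP (by rw [Prem]; exact rfl))
  | node cs φ ih =>
    refine .step (r := ⟨cs.map Conc, φ⟩) (hR (mem_rules_node.2 (.inl rfl))) fun q hq => ?_
    obtain ⟨c, hc, rfl⟩ := List.mem_map.1 hq
    exact ih c hc (fun x hx => hP (mem_prem_node.2 ⟨c, hc, hx⟩))
      fun r hr => hR (mem_rules_node.2 (.inr ⟨c, hc, hr⟩))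

/-- If every proposition is obtained in at most one way, either as a premise or from a single
rule, then an argument is determined by its conclusion. -/
theorem eq_of_conc_eq {P : Set L} {R : Set (ArgRule L)} (hPR : ∀ r ∈ R, r.concl ∉ P)
    (hinj : Set.InjOn ArgRule.concl R) {A B : Arg L}
    (hAP : A.Prem ⊆ P) (hAR : A.Rules ⊆ R) (hBP : B.Prem ⊆ P) (hBR : B.Rules ⊆ R)
    (h : A.Conc = B.Conc) : A = B := by
  have mem_of_atom {φ : L} (hφ : (atom φ).Prem ⊆ P) : φ ∈ P := hφ (by rw [Prem]; exact rfl)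
  have top_mem {cs : List (Arg L)} {φ : L} (hφ : (node cs φ).Rules ⊆ R) :
      (⟨cs.map Conc, φ⟩ : ArgRule L) ∈ R := hφ (mem_rules_node.2 (.inl rfl))
  induction A using induction_on_children generalizing B with
  | atom φ =>
    cases B with
    | atom ψ => exact congrArg atom h
    | node cs ψ =>
      obtain rfl : φ = ψ := h
      exact absurd (mem_of_atom hAP) (hPR _ (top_mem hBR))
  | node cs φ ih =>
    cases B with
    | atom ψ =>
      obtain rfl : φ = ψ := h
      exact absurd (mem_of_atom hBP) (hPR _ (top_mem hAR))
    | node ds ψ =>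
      obtain rfl : φ = ψ := h
      have hmap : cs.map Conc = ds.map Conc :=
        congrArg ArgRule.prems (hinj (top_mem hAR) (top_mem hBR) rfl)
      have hlen : cs.length = ds.length := by simpa using congrArg List.length hmap
      congr 1
      refine List.ext_getElem hlen fun i hi hj => ?_
      have hc := List.getElem_mem hi
      have hd := List.getElem_mem hj
      refine ih _ hc (fun x hx => hAP (mem_prem_node.2 ⟨_, hc, hx⟩))
        (fun r hr => hAR (mem_rules_node.2 (.inr ⟨_, hc, hr⟩)))
        (fun x hx => hBP (mem_prem_node.2 ⟨_, hd, hx⟩))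
        (fun r hr => hBR (mem_rules_node.2 (.inr ⟨_, hd, hr⟩))) ?_
      have hget := List.getElem_of_eq hmap (i := i) (by simpa using hi)
      simpa using hget

theorem Minimal.regular {A : Arg L} (hA : A.Minimal) : A.Regular := by
  rintro ⟨A₁, h₁, A₂, h₂, hne, hc⟩
  have hinf : Infers A.Prem A.Rules A.Conc := infers_conc subset_rfl subset_rfl
  refine hne (eq_of_conc_eq (P := A.Prem) (R := A.Rules) (fun r hr hmem => hA.2 ?_)
    (fun r hr s hs hrs => ?_) (prem_subset_of_mem_sub h₁) (rules_subset_of_mem_sub h₁)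
    (prem_subset_of_mem_sub h₂) (rules_subset_of_mem_sub h₂) hc)
  · exact ⟨A.Rules \ {r}, Set.sdiff_singleton_ssubset.2 hr, hinf.diff_of_concl_mem hmem⟩
  · by_contra hrs_ne
    exact hA.2 (hinf.exists_ssubset_of_concl_eq hr hs hrs_ne hrs)

end Arg

/-- A redundant argument is not minimal. -/
theorem stmt_10 {L : Type} (AT : ArgTheory L) (A : Arg L) (hA : A.IsArg AT)
    (hred : A.Redundant) : ¬ A.Minimal := by
  obtain ⟨A₁, h₁, A₂, h₂, hne, hc, -⟩ := hred
  exact fun hmin => hmin.regular ⟨A₁, h₁, A₂, h₂, hne, hc⟩
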